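/- Let E be a real separable Banach space and P a Gaussian Borel probability measure on E with mean μ := ∫_E ω dP(ω) and covariance kernel K(L₁,L₂) := ∫_E (L₁ω − L₁μ)(L₂ω − L₂μ) dP(ω). Let U : E → ℝ be Borel measurable with ∫_E U² dP < ∞ and u := ∫_E ω U(ω) dP(ω) (Bochner integral). Let L, L₁,…,Lₙ ∈ E* with A_n := (K(L_j,L_k))_{j,k=1}^n positive definite with smallest eigenvalue λ_min(A_n); set b_n(L) := (K(L,L₁),…,K(L,Lₙ))ᵀ, β := A_n⁻¹b_n(L), m_n := (L₁μ,…,Lₙμ)ᵀ, σ_n(L) := (K(L,L) − b_n(L)ᵀA_n⁻¹b_n(L))^{1/2}, C₁ := (∫_E U²dP)^{1/2}, C₂ := |∫_E U dP − 1|. Let ε_n > 0 and f̂_n ∈ ℝⁿ with ‖f̂_n − (L₁u,…,Lₙu)ᵀ‖₂ ≤ ε_n, let Q_n be the pushforward of P under ω ↦ (L₁ω,…,Lₙω)ᵀ, B_n := {v : ‖v − f̂_n‖₂ ≤ ε_n}, and η_n := (∫_{B_n} v dQ_n(v))/Q_n(B_n). Then the noisy kernel-based estimator ŝ_n(L) :=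 Lμ + βᵀ(η_n − m_n) satisfies |Lu − ŝ_n(L)| ≤ C₁ σ_n(L) + C₂ |Lμ − βᵀ m_n| + 2 (K(L,L)/λ_min(A_n))^{1/2} ε_n. -/

import Mathlib

open MeasureTheory ProbabilityTheory Matrix

open scoped MatrixOrder in
theorem Matrix.IsHermitian.mul_dotProduct_self_le {ι : Type*} [Fintype ι] [DecidableEq ι]
    {A : Matrix ι ι ℝ} (hA : A.IsHermitian) {r : ℝ} (hr : ∀ i, r ≤ hA.eigenvalues i)
    (x : ι → ℝ) : r * (x ⬝ᵥ x) ≤ x ⬝ᵥ A *ᵥ x := by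
  have h : algebraMap ℝ (Matrix ι ι ℝ) r ≤ A := by
    rw [algebraMap_le_iff_le_spectrum (a := A) (ha := hA), hA.spectrum_real_eq_range_eigenvalues]
    rintro _ ⟨i, rfl⟩
    exact hr i
  have h' := (Matrix.le_iff.mp h).dotProduct_mulVec_nonneg x
  simp only [Algebra.algebraMap_eq_smul_one, sub_mulVec, smul_mulVec, one_mulVec, star_trivial,
    dotProduct_sub, dotProduct_smul, smul_eq_mul] at h'
  linarith

theorem ProbabilityTheory.isOpenPosMeasure_gaussianReal (m : ℝ) {v : NNReal} (hv : v ≠ 0) :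
    (gaussianReal m v).IsOpenPosMeasure :=
  (gaussianReal_absolutelyContinuous' m hv).isOpenPosMeasure

theorem ProbabilityTheory.isOpenPosMeasure_stdGaussian {ι : Type*} [Fintype ι] :
    (stdGaussian (EuclideanSpace ℝ ι)).IsOpenPosMeasure := by
  have := isOpenPosMeasure_gaussianReal 0 one_ne_zero
  rw [← map_pi_eq_stdGaussian]
  exact (PiLp.continuous_toLp 2 _).isOpenPosMeasure_map (WithLp.toLp_surjective 2)

open scoped MatrixOrder in
theorem ProbabilityTheory.isOpenPosMeasure_multivariateGaussian {ι : Type*} [Fintype ι]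
    [DecidableEq ι] (m : EuclideanSpace ℝ ι) {S : Matrix ι ι ℝ} (hS : S.PosDef) :
    (multivariateGaussian m S).IsOpenPosMeasure := by
  have := isOpenPosMeasure_stdGaussian (ι := ι)
  refine Continuous.isOpenPosMeasure_map (by fun_prop) fun y ↦ ?_
  have hmul : CFC.sqrt S * (CFC.sqrt S * S⁻¹) = 1 := by
    rw [← mul_assoc, CFC.sqrt_mul_sqrt_self S hS.posSemidef.nonneg,
      mul_nonsing_inv S ((isUnit_iff_isUnit_det S).mp hS.isUnit)]
  refine ⟨toEuclideanCLM (𝕜 := ℝ) (CFC.sqrt S * S⁻¹) (y - m), ?_⟩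
  rw [← mul_apply_eq_comp, ← map_mul, hmul]
  simp

theorem ProbabilityTheory.IsGaussian.eq_multivariateGaussian {ι : Type*} [Fintype ι]
    [DecidableEq ι] (Q : Measure (EuclideanSpace ℝ ι)) [IsGaussian Q] {S : Matrix ι ι ℝ}
    (hS : S.PosSemidef) (hcov : ∀ i j, cov[fun x ↦ x i, fun x ↦ x j; Q] = S i j) :
    Q = multivariateGaussian (∫ x, x ∂Q) S := by
  apply IsGaussian.ext
  · simp
  rw [← ContinuousLinearMap.toBilinForm_inj]
  refine LinearMap.BilinForm.ext_basis (EuclideanSpace.basisFun ι ℝ).toBasis fun i j ↦ ?_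
  have h (i : ι) : (fun x : EuclideanSpace ℝ ι ↦
      inner ℝ ((EuclideanSpace.basisFun ι ℝ).toBasis i) x) = fun x ↦ x i := by
    ext; simp [PiLp.inner_apply]
  rw [ContinuousLinearMap.toBilinForm_apply, ContinuousLinearMap.toBilinForm_apply,
    covarianceBilin_apply_eq_cov IsGaussian.memLp_two_id,
    covarianceBilin_apply_eq_cov IsGaussian.memLp_two_id, h, h, hcov,
    covariance_eval_multivariateGaussian hS]

theorem ProbabilityTheory.IsGaussian.isOpenPosMeasure_map_pi {E ι : Type*} [NormedAddCommGroup E]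
    [NormedSpace ℝ E] [MeasurableSpace E] [BorelSpace E] [Fintype ι] [DecidableEq ι]
    (P : Measure E) [IsGaussian P] (L : ι → E →L[ℝ] ℝ) {S : Matrix ι ι ℝ} (hS : S.PosDef)
    (hcov : ∀ i j, cov[L i, L j; P] = S i j) :
    (P.map fun ω i ↦ L i ω).IsOpenPosMeasure := by
  let X : E →L[ℝ] EuclideanSpace ℝ ι :=
    (EuclideanSpace.equiv ι ℝ).symm.toContinuousLinearMap ∘L ContinuousLinearMap.pi L
  have hmap : P.map X = multivariateGaussian (∫ x, x ∂(P.map X)) S := by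
    refine IsGaussian.eq_multivariateGaussian _ hS.posSemidef fun i j ↦ ?_
    rw [covariance_map (by fun_prop) (by fun_prop) (by fun_prop)]
    exact hcov i j
  have hpos : (P.map X).IsOpenPosMeasure := by
    rw [hmap]
    exact isOpenPosMeasure_multivariateGaussian _ hS
  have : P.map (fun ω i ↦ L i ω) = (P.map X).map WithLp.ofLp := by
    rw [Measure.map_map (by fun_prop) (by fun_prop)]
    rfl
  rw [this]
  exact (PiLp.continuous_ofLp 2 _).isOpenPosMeasure_map (WithLp.ofLp_surjective 2)

theorem setOf_sum_sub_sq_le_eq {ι : Type*} [Fintype ι] (c : ι → ℝ) {r : ℝ} (hr : 0 ≤ r) :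
    {v : ι → ℝ | ∑ i, (v i - c i) ^ 2 ≤ r ^ 2} =
      (WithLp.linearEquiv 2 ℝ (ι → ℝ)).symm ⁻¹' Metric.closedBall (WithLp.toLp 2 c) r := by
  ext v
  rw [Set.mem_preimage, mem_closedBall_iff_norm, Set.mem_ofPred_eq, ← sq_le_sq₀ (norm_nonneg _) hr,
    EuclideanSpace.real_norm_sq_eq]
  simp

theorem convex_setOf_sum_sub_sq_le {ι : Type*} [Fintype ι] (c : ι → ℝ) {r : ℝ} (hr : 0 ≤ r) :
    Convex ℝ {v : ι → ℝ | ∑ i, (v i - c i) ^ 2 ≤ r ^ 2} := by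
  rw [setOf_sum_sub_sq_le_eq c hr]
  exact (convex_closedBall _ _).linear_preimage
    (WithLp.linearEquiv 2 ℝ (ι → ℝ)).symm.toLinearMap

theorem sum_sub_sq_le_of_sum_sub_sq_le {ι : Type*} [Fintype ι] {x y c : ι → ℝ} {r : ℝ}
    (hx : ∑ i, (x i - c i) ^ 2 ≤ r ^ 2) (hy : ∑ i, (y i - c i) ^ 2 ≤ r ^ 2) :
    ∑ i, (x i - y i) ^ 2 ≤ (2 * r) ^ 2 := by
  have key : ∑ i, (x i - y i) ^ 2 ≤
      2 * ∑ i, (x i - c i) ^ 2 + 2 * ∑ i, (y i - c i) ^ 2 := by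
    rw [Finset.mul_sum, Finset.mul_sum, ← Finset.sum_add_distrib]
    exact Finset.sum_le_sum fun i _ ↦ by nlinarith [sq_nonneg (x i - c i + (y i - c i))]
  nlinarith

theorem abs_integral_mul_le_sqrt_mul_sqrt {α : Type*} [MeasurableSpace α] {P : Measure α}
    {f g : α → ℝ} (hf : MemLp f 2 P) (hg : MemLp g 2 P) :
    |∫ x, f x * g x ∂P| ≤ Real.sqrt (∫ x, f x ^ 2 ∂P) * Real.sqrt (∫ x, g x ^ 2 ∂P) := by
  have h2 : ENNReal.ofReal 2 = 2 := by norm_num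
  have h := integral_mul_norm_le_Lp_mul_Lq (μ := P) (f := f) (g := g)
    Real.HolderConjugate.two_two (by rwa [h2]) (by rwa [h2])
  simp only [Real.norm_eq_abs, Real.rpow_two, sq_abs, ← Real.sqrt_eq_rpow] at h
  refine (abs_integral_le_integral_abs).trans ?_
  simpa only [abs_mul] using h

/-- Error bound for the noisy kernel-based estimator. `P` is a
Gaussian Borel probability measure on a real separable Banach space with mean `μ`
and covariance kernel `K`; `U ∈ L²(P)` and `u = ∫ ω U(ω) dP(ω)`. With noisy data
`f̂ₙ` (`‖f̂ₙ − fₙ‖₂ ≤ εₙ`), `ηₙ` the mean of the pushforward `Qₙ` conditioned on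
the ball `Bₙ`, `β = Aₙ⁻¹bₙ(T)`, `σₙ(T)² = K(T,T) − bₙ(T)ᵀAₙ⁻¹bₙ(T)`,
`C₁ = (∫U²dP)^{1/2}`, `C₂ = |∫UdP − 1|` and `λ_min` the smallest eigenvalue of
`Aₙ`, the noisy estimator `ŝₙ(T) = Tμ + βᵀ(ηₙ − mₙ)` satisfies
`|Tu − ŝₙ(T)| ≤ C₁σₙ(T) + C₂|Tμ − βᵀmₙ| + 2(K(T,T)/λ_min)^{1/2} εₙ`. -/
theorem noisy_kernel_estimator_error_bound
    {E : Type*} [NormedAddCommGroup E] [NormedSpace ℝ E] [CompleteSpace E]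
    [TopologicalSpace.SeparableSpace E] [MeasurableSpace E] [BorelSpace E]
    (P : Measure E) [IsProbabilityMeasure P]
    (hGauss : ∀ L : E →L[ℝ] ℝ, ∃ (m : ℝ) (v : NNReal), P.map L = gaussianReal m v)
    (μ : E) (hμ : μ = ∫ ω, ω ∂P)
    (K : (E →L[ℝ] ℝ) → (E →L[ℝ] ℝ) → ℝ)
    (hK : ∀ L₁ L₂ : E →L[ℝ] ℝ, K L₁ L₂ = ∫ ω, (L₁ ω - L₁ μ) * (L₂ ω - L₂ μ) ∂P)
    (U : E → ℝ) (hUmeas : Measurable U)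
    (hU2 : Integrable (fun ω => U ω ^ 2) P)
    (u : E) (hu : u = ∫ ω, U ω • ω ∂P)
    {n : ℕ} (T : E →L[ℝ] ℝ) (L : Fin n → (E →L[ℝ] ℝ))
    (A : Matrix (Fin n) (Fin n) ℝ) (hA : ∀ j k, A j k = K (L j) (L k))
    (hApd : A.PosDef)
    (lammin : ℝ) (hlam : IsLeast (Set.range hApd.1.eigenvalues) lammin)
    (b : Fin n → ℝ) (hb : ∀ i, b i = K T (L i))
    (β : Fin n → ℝ) (hβ : β = A⁻¹.mulVec b)
    (ε : ℝ) (hε : 0 < ε)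
    (fhat : Fin n → ℝ) (hdata : ∑ i, (fhat i - L i u) ^ 2 ≤ ε ^ 2)
    (Qn : Measure (Fin n → ℝ)) (hQn : Qn = P.map (fun ω (i : Fin n) => L i ω))
    (B : Set (Fin n → ℝ)) (hB : B = {v : Fin n → ℝ | ∑ i, (v i - fhat i) ^ 2 ≤ ε ^ 2})
    (η : Fin n → ℝ) (hη : ∀ i, η i = (∫ v in B, v i ∂Qn) / (Qn B).toReal) :
    |T u - (T μ + β ⬝ᵥ (fun i => η i - L i μ))| ≤
      Real.sqrt (∫ ω, U ω ^ 2 ∂P) * Real.sqrt (K T T - b ⬝ᵥ A⁻¹.mulVec b) +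
        |(∫ ω, U ω ∂P) - 1| * |T μ - β ⬝ᵥ (fun i => L i μ)| +
          2 * Real.sqrt (K T T / lammin) * ε := by
  have : IsGaussian P := isGaussian_of_map_eq_gaussianReal hGauss
  have : SecondCountableTopology E := UniformSpace.secondCountable_of_separable E
  have hKcov (L₁ L₂ : E →L[ℝ] ℝ) : K L₁ L₂ = cov[L₁, L₂; P] := by
    rw [hK, covariance, IsGaussian.integral_dual, IsGaussian.integral_dual, ← hμ]
  have hKbil (L₁ L₂ : E →L[ℝ] ℝ) : K L₁ L₂ = covarianceBilinDual P L₁ L₂ := by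
    rw [hKcov, covarianceBilinDual_eq_covariance IsGaussian.memLp_two_id]
  have hUL : MemLp U 2 P := (memLp_two_iff_integrable_sq hUmeas.aestronglyMeasurable).mpr hU2
  have hUω : Integrable (fun ω ↦ U ω • ω) P :=
    memLp_one_iff_integrable.mp ((IsGaussian.memLp_two_id (μ := P)).smul hUL)
  -- the residual functional of the kernel interpolant
  let W : E →L[ℝ] ℝ := T - ∑ i, β i • L i
  have hW (x : E) : W x = T x - β ⬝ᵥ fun i ↦ L i x := by
    simp [W, dotProduct]
  have hAβ : A *ᵥ β = b := by
    rw [hβ, mulVec_mulVec, mul_nonsing_inv A ((isUnit_iff_isUnit_det A).mp hApd.isUnit),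
      one_mulVec]
  have hKWW : K W W = K T T - b ⬝ᵥ A⁻¹ *ᵥ b := by
    have hTL : ∑ i, β i * K T (L i) = b ⬝ᵥ β := by
      simp_rw [← hb, dotProduct, mul_comm]
    have hLT : ∑ i, β i * K (L i) T = b ⬝ᵥ β := by
      rw [← hTL]
      simp_rw [hKcov, covariance_comm]
    have hLL : ∑ i, β i * ∑ j, β j * K (L i) (L j) = b ⬝ᵥ β := by
      rw [dotProduct_comm, ← hAβ]
      simp_rw [dotProduct, mulVec, dotProduct, hA, mul_comm]
    have hexp : K W W = K T T - ∑ i, β i * K T (L i) - (∑ i, β i * K (L i) T -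
        ∑ i, β i * ∑ j, β j * K (L i) (L j)) := by
      simp only [hKbil, W, map_sub, map_sum, map_smul, _root_.sub_apply,
        _root_.sum_apply, _root_.smul_apply, smul_eq_mul,
        mul_sub, Finset.sum_sub_distrib]
      simp only [Finset.mul_sum]
      rw [Finset.sum_comm]
      ring_nf
      simp only [mul_comm (β _) (β _)]
    rw [hexp, hTL, hLT, hLL, ← hβ]
    ring
  have hnonneg (L₁ : E →L[ℝ] ℝ) : 0 ≤ K L₁ L₁ := by
    rw [hK]
    exact integral_nonneg fun ω ↦ mul_self_nonneg _
  have hcenter : MemLp (fun ω ↦ W ω - W μ) 2 P :=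
    (IsGaussian.memLp_dual P W 2 (by simp)).sub (memLp_const _)
  have hres : |W u - W μ| ≤ Real.sqrt (∫ ω, U ω ^ 2 ∂P) * Real.sqrt (K T T - b ⬝ᵥ A⁻¹ *ᵥ b) +
      |(∫ ω, U ω ∂P) - 1| * |W μ| := by
    have hWu : W u = ∫ ω, U ω * W ω ∂P := by
      rw [hu, ← W.integral_comp_comm hUω]
      simp
    have hsplit : W u - W μ = ∫ ω, U ω * (W ω - W μ) ∂P + ((∫ ω, U ω ∂P) - 1) * W μ := by
      have hUW : Integrable (fun ω ↦ U ω * W ω) P :=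
        hUL.integrable_mul (IsGaussian.memLp_dual P W 2 (by simp))
      simp_rw [mul_sub]
      rw [integral_sub hUW ((hUL.integrable (by norm_num)).mul_const _), integral_mul_const, hWu]
      ring
    rw [hsplit, ← hKWW, hK, ← abs_mul]
    refine (abs_add_le _ _).trans (add_le_add_left ?_ _)
    simpa only [sq] using abs_integral_mul_le_sqrt_mul_sqrt hUL hcenter
  have hQpos : Qn.IsOpenPosMeasure := by
    rw [hQn]
    refine IsGaussian.isOpenPosMeasure_map_pi P L hApd fun i j ↦ ?_
    rw [hA, hKcov]
  have hQgauss : IsGaussian Qn := by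
    rw [hQn]
    exact isGaussian_map (ContinuousLinearMap.pi L)
  have hBclosed : IsClosed B := by
    rw [hB]
    exact isClosed_le (by fun_prop) continuous_const
  have hQB : Qn B ≠ 0 := by
    have hopen : IsOpen {v : Fin n → ℝ | ∑ i, (v i - fhat i) ^ 2 < ε ^ 2} :=
      isOpen_lt (by fun_prop) continuous_const
    refine fun h0 ↦ hopen.measure_ne_zero Qn ⟨fhat, by simpa using pow_pos hε 2⟩
      (measure_mono_null ?_ h0)
    rw [hB]
    exact Set.ofPred_subset_ofPred.mpr fun v hv ↦ hv.le
  have hηB : η ∈ B := by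
    have hint : IntegrableOn (fun v : Fin n → ℝ ↦ v) B Qn :=
      (IsGaussian.integrable_id (μ := Qn)).integrableOn
    have hη' : η = ⨍ v in B, v ∂Qn := by
      ext i
      rw [hη, setAverage_eq, Pi.smul_apply, smul_eq_mul, eval_integral fun j ↦ hint.eval j,
        div_eq_inv_mul]
      rfl
    rw [hη']
    refine Convex.set_average_mem ?_ hBclosed hQB (measure_ne_top _ _)
      (ae_restrict_mem hBclosed.measurableSet) hint
    rw [hB]
    exact convex_setOf_sum_sub_sq_le fhat hε.le
  have hlam_pos : 0 < lammin := by
    obtain ⟨i, rfl⟩ := hlam.1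
    exact hApd.eigenvalues_pos i
  have hβ_le : β ⬝ᵥ β ≤ K T T / lammin := by
    have h := hApd.1.mul_dotProduct_self_le (fun i ↦ hlam.2 (Set.mem_range_self i)) β
    have h' := hnonneg W
    rw [hKWW, ← hβ] at h'
    rw [hAβ, dotProduct_comm β b] at h
    rw [le_div_iff₀ hlam_pos]
    linarith
  have hdist : ∑ i, (L i u - η i) ^ 2 ≤ (2 * ε) ^ 2 := by
    refine sum_sub_sq_le_of_sum_sub_sq_le (c := fhat) ?_ ?_
    · simpa only [sub_sq_comm] using hdata
    · rwa [hB] at hηB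
  have hnoise : |β ⬝ᵥ fun i ↦ L i u - η i| ≤ 2 * Real.sqrt (K T T / lammin) * ε := by
    apply abs_le_of_sq_le_sq _ (by positivity)
    calc (β ⬝ᵥ fun i ↦ L i u - η i) ^ 2
        ≤ (∑ i, β i ^ 2) * ∑ i, (L i u - η i) ^ 2 := Finset.sum_mul_sq_le_sq_mul_sq _ _ _
      _ ≤ (K T T / lammin) * (2 * ε) ^ 2 := by
        refine mul_le_mul ?_ hdist (Finset.sum_nonneg fun i _ ↦ sq_nonneg _)
          (div_nonneg (hnonneg T) hlam_pos.le)
        simpa only [dotProduct, sq] using hβ_le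
      _ = (2 * Real.sqrt (K T T / lammin) * ε) ^ 2 := by
        rw [mul_pow, mul_pow, mul_pow, Real.sq_sqrt (div_nonneg (hnonneg T) hlam_pos.le)]
        ring
  have hdecomp : T u - (T μ + β ⬝ᵥ fun i ↦ η i - L i μ) =
      (W u - W μ) + β ⬝ᵥ fun i ↦ L i u - η i := by
    simp only [hW, dotProduct, mul_sub, Finset.sum_sub_distrib]
    ring
  rw [hdecomp, ← hW]
  exact (abs_add_le _ _).trans (add_le_add hres hnoise)
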